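/- Suppose the rate pair (R₁₂, 0) is admissible for q with r = 1 round of communication (a single message from node 1 to node 2). Then under q the Markov chain Y¹ – X¹ – X² holds, i.e. I_q(Y¹; X² | X¹) = 0. -/

import Mathlib

open scoped BigOperators
open Finset

noncomputable section

namespace Coord

variable {Ω α β γ : Type*}

/-- `p` is a probability mass function on the finite type `α`. -/
def IsPMF [Fintype α] (p : α → ℝ) : Prop := (∀ a, 0 ≤ p a) ∧ ∑ a, p a = 1

/-- ℓ¹ (total variation) distance between two functions on a finite type. -/
def l1dist [Fintype α] (p q : α → ℝ) : ℝ := ∑ a, |p a - q a|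

/-- The distribution (pushforward pmf) of the random variable `X` defined on the
finite sample space `Ω` carrying the pmf `μ`. -/
def distr [Fintype Ω] [DecidableEq α] (μ : Ω → ℝ) (X : Ω → α) : α → ℝ :=
  fun a => ∑ ω, if X ω = a then μ ω else 0

/-- Shannon entropy (base 2) of a pmf. -/
def entFun [Fintype α] (p : α → ℝ) : ℝ := - ∑ a, p a * Real.logb 2 (p a)

/-- Shannon entropy `H(X)` of a random variable `X` on `(Ω, μ)`. -/
def H [Fintype Ω] [Fintype α] [DecidableEq α] (μ : Ω → ℝ) (X : Ω → α) : ℝ :=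
  entFun (distr μ X)

/-- Conditional entropy `H(X | Z)`. -/
def condEnt [Fintype Ω] [Fintype α] [Fintype γ] [DecidableEq α] [DecidableEq γ]
    (μ : Ω → ℝ) (X : Ω → α) (Z : Ω → γ) : ℝ :=
  H μ (fun ω => (X ω, Z ω)) - H μ Z

/-- Mutual information `I(X; Y)`. -/
def mi [Fintype Ω] [Fintype α] [Fintype β] [DecidableEq α] [DecidableEq β]
    (μ : Ω → ℝ) (X : Ω → α) (Y : Ω → β) : ℝ :=
  H μ X + H μ Y - H μ (fun ω => (X ω, Y ω))

/-- Conditional mutual information `I(X; Y | Z)`. -/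
def cmi [Fintype Ω] [Fintype α] [Fintype β] [Fintype γ]
    [DecidableEq α] [DecidableEq β] [DecidableEq γ]
    (μ : Ω → ℝ) (X : Ω → α) (Y : Ω → β) (Z : Ω → γ) : ℝ :=
  H μ (fun ω => (X ω, Z ω)) + H μ (fun ω => (Y ω, Z ω))
    - H μ (fun ω => (X ω, Y ω, Z ω)) - H μ Z

variable {𝒳₁ 𝒳₂ 𝒴₁ 𝒴₂ : Type}

/-- The `(x¹, x²)`-marginal of `q(x¹, x², y¹, y²)`. -/
def srcMarg [Fintype 𝒴₁] [Fintype 𝒴₂] (q : 𝒳₁ × 𝒳₂ × 𝒴₁ × 𝒴₂ → ℝ) :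
    𝒳₁ × 𝒳₂ → ℝ := fun x => ∑ y₁, ∑ y₂, q (x.1, x.2, y₁, y₂)

/-- The rate pair `(R12, R21)` is admissible for the coordination problem `q` with `r`
interactive rounds of communication: for every `ε > 0`, for all large enough block
lengths `n`, there is a finite probability space carrying the i.i.d. sources, private
randomness `M₁, M₂`, interactive messages `C i` (messages with even Lean-index,
i.e. odd 1-based index, are sent by the first node), and outputs `Y₁, Y₂`,
meeting the rate constraints and approximating the i.i.d. target distribution
within total variation `ε`. -/
def Admissible [Fintype 𝒳₁] [Fintype 𝒳₂] [Fintype 𝒴₁] [Fintype 𝒴₂]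
    [DecidableEq 𝒳₁] [DecidableEq 𝒳₂] [DecidableEq 𝒴₁] [DecidableEq 𝒴₂]
    (q : 𝒳₁ × 𝒳₂ × 𝒴₁ × 𝒴₂ → ℝ) (r : ℕ) (R12 R21 : ℝ) : Prop :=
  ∀ ε : ℝ, 0 < ε → ∃ n₀ : ℕ, ∀ n : ℕ, n₀ ≤ n →
    ∃ (Ω 𝓜₁ 𝓜₂ : Type) (𝓒 : Fin r → Type)
      (_ : Fintype Ω) (_ : DecidableEq Ω)
      (_ : Fintype 𝓜₁) (_ : DecidableEq 𝓜₁)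
      (_ : Fintype 𝓜₂) (_ : DecidableEq 𝓜₂)
      (_ : ∀ i, Fintype (𝓒 i)) (_ : ∀ i, DecidableEq (𝓒 i))
      (μ : Ω → ℝ)
      (X₁ : Ω → Fin n → 𝒳₁) (X₂ : Ω → Fin n → 𝒳₂)
      (M₁ : Ω → 𝓜₁) (M₂ : Ω → 𝓜₂)
      (C : (i : Fin r) → Ω → 𝓒 i)
      (Y₁ : Ω → Fin n → 𝒴₁) (Y₂ : Ω → Fin n → 𝒴₂),
      IsPMF μ ∧
      -- the source pairs are i.i.d. with per-letter distribution the (x¹,x²)-marginal of q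
      (distr μ (fun ω => (X₁ ω, X₂ ω)) =
        fun x => ∏ k, srcMarg q (x.1 k, x.2 k)) ∧
      -- M₁, M₂ and the sources are mutually independent
      (distr μ (fun ω => (M₁ ω, M₂ ω, X₁ ω, X₂ ω)) =
        fun m => distr μ M₁ m.1 * distr μ M₂ m.2.1 *
          distr μ (fun ω => (X₁ ω, X₂ ω)) m.2.2) ∧
      -- messages with odd 1-based index are functions of (previous messages, X¹, M₁)
      (∀ i : Fin r, (i : ℕ) % 2 = 0 →
        condEnt μ (C i)
          (fun ω => ((fun j : Fin (i : ℕ) => C ⟨j.1, j.2.trans i.2⟩ ω), X₁ ω, M₁ ω)) = 0) ∧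
      -- messages with even 1-based index are functions of (previous messages, X², M₂)
      (∀ i : Fin r, (i : ℕ) % 2 = 1 →
        condEnt μ (C i)
          (fun ω => ((fun j : Fin (i : ℕ) => C ⟨j.1, j.2.trans i.2⟩ ω), X₂ ω, M₂ ω)) = 0) ∧
      -- rate constraints
      (∑ i ∈ Finset.univ.filter (fun i : Fin r => (i : ℕ) % 2 = 0), H μ (C i)) ≤ n * R12 ∧
      (∑ i ∈ Finset.univ.filter (fun i : Fin r => (i : ℕ) % 2 = 1), H μ (C i)) ≤ n * R21 ∧
      -- the outputs are produced from the locally available information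
      condEnt μ Y₁ (fun ω => (X₁ ω, M₁ ω, fun i : Fin r => C i ω)) = 0 ∧
      condEnt μ Y₂ (fun ω => (X₂ ω, M₂ ω, fun i : Fin r => C i ω)) = 0 ∧
      -- total variation distance to the i.i.d. target is at most ε
      l1dist (distr μ (fun ω => (X₁ ω, X₂ ω, Y₁ ω, Y₂ ω)))
        (fun a => ∏ k, q (a.1 k, a.2.1 k, a.2.2.1 k, a.2.2.2 k)) ≤ ε

/-- Summing a pmf over the event `P (X ω)` agrees with summing the distribution of `X` over `P`. -/
lemma sum_ite_comp_eq_sum_distr [Fintype Ω] [Fintype α] [DecidableEq α]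
    (μ : Ω → ℝ) (X : Ω → α) (P : α → Prop) [DecidablePred P] :
    (∑ ω, if P (X ω) then μ ω else 0) = ∑ a, if P a then distr μ X a else 0 := by
  simp only [distr, ← Finset.sum_filter (fun a => P a)]
  rw [Finset.sum_comm]
  refine Finset.sum_congr rfl fun ω _ => ?_
  rw [Finset.sum_ite_eq]
  simp

lemma sum_mul_comp_eq_sum_distr [Fintype Ω] [Fintype α] [DecidableEq α]
    (μ : Ω → ℝ) (X : Ω → α) (f : α → ℝ) :
    ∑ ω, μ ω * f (X ω) = ∑ a, distr μ X a * f a := by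
  simp only [distr, Finset.sum_mul]
  rw [Finset.sum_comm]
  refine Finset.sum_congr rfl fun ω _ => ?_
  simp [ite_mul]

lemma distr_nonneg [Fintype Ω] [DecidableEq α] {μ : Ω → ℝ} (hμ : ∀ ω, 0 ≤ μ ω)
    (X : Ω → α) (a : α) : 0 ≤ distr μ X a :=
  Finset.sum_nonneg fun ω _ => by split_ifs <;> simp [hμ]

lemma le_distr_self [Fintype Ω] [DecidableEq α] {μ : Ω → ℝ} (hμ : ∀ ω, 0 ≤ μ ω)
    (X : Ω → α) (ω : Ω) : μ ω ≤ distr μ X (X ω) := by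
  have h := Finset.single_le_sum (f := fun ω' => if X ω' = X ω then μ ω' else 0)
    (fun ω' _ => by split_ifs <;> simp [hμ]) (Finset.mem_univ ω)
  simpa [distr] using h

lemma distr_prodMk_add_le [Fintype Ω] [DecidableEq α] [DecidableEq γ] {μ : Ω → ℝ}
    (hμ : ∀ ω, 0 ≤ μ ω) (X : Ω → α) (Z : Ω → γ) (x : α) (ω : Ω) (hx : X ω ≠ x) :
    distr μ (fun ω => (X ω, Z ω)) (x, Z ω) + μ ω ≤ distr μ Z (Z ω) := by
  classical
  have h : μ ω = ∑ ω', if ω' = ω then μ ω' else 0 := by simp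
  rw [h]
  simp only [distr]
  rw [← Finset.sum_add_distrib]
  refine Finset.sum_le_sum fun ω' _ => ?_
  have := hμ ω'
  by_cases h1 : ω' = ω
  · subst h1
    simp [hx]
  · simp only [Prod.mk.injEq, h1, if_false, add_zero]
    split_ifs <;> simp_all

lemma H_eq_neg_sum [Fintype Ω] [Fintype α] [DecidableEq α] (μ : Ω → ℝ) (X : Ω → α) :
    H μ X = - ∑ ω, μ ω * Real.logb 2 (distr μ X (X ω)) := by
  rw [sum_mul_comp_eq_sum_distr μ X (fun a => Real.logb 2 (distr μ X a))]
  rfl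

/-- If `H(X | Z) = 0`, then `X` is determined by `Z` on the support of `μ`. -/
lemma eq_of_condEnt_eq_zero [Fintype Ω] [Fintype α] [Fintype γ] [DecidableEq α] [DecidableEq γ]
    {μ : Ω → ℝ} (hμ : ∀ ω, 0 ≤ μ ω) {X : Ω → α} {Z : Ω → γ} (h : condEnt μ X Z = 0)
    {ω ω' : Ω} (hω : μ ω ≠ 0) (hω' : μ ω' ≠ 0) (hZ : Z ω = Z ω') : X ω = X ω' := by
  by_contra hne
  have hpos : 0 < μ ω := lt_of_le_of_ne (hμ ω) hω.symm
  have hpos' : 0 < μ ω' := lt_of_le_of_ne (hμ ω') hω'.symm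
  have hle (v : Ω) :
      distr μ (fun ω => (X ω, Z ω)) (X v, Z v) ≤ distr μ Z (Z v) := by
    refine Finset.sum_le_sum fun u _ => ?_
    have := hμ u
    simp only [Prod.mk.injEq]
    split_ifs <;> simp_all
  have hlog (v : Ω) :
      0 ≤ μ v * (Real.logb 2 (distr μ Z (Z v))
        - Real.logb 2 (distr μ (fun ω => (X ω, Z ω)) (X v, Z v))) := by
    rcases (hμ v).eq_or_lt with hv | hv
    · simp [← hv]
    · refine mul_nonneg hv.le (sub_nonneg.2 ?_)
      exact Real.logb_le_logb_of_le one_lt_two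
        (hv.trans_le (le_distr_self hμ (fun ω => (X ω, Z ω)) v)) (hle v)
  have hsum : ∑ v, μ v * (Real.logb 2 (distr μ Z (Z v))
        - Real.logb 2 (distr μ (fun ω => (X ω, Z ω)) (X v, Z v))) = 0 := by
    rw [← h, condEnt, H_eq_neg_sum, H_eq_neg_sum]
    simp only [mul_sub, Finset.sum_sub_distrib]
    ring
  have hzero := (Finset.sum_eq_zero_iff_of_nonneg fun v _ => hlog v).1 hsum ω (Finset.mem_univ _)
  have hlt : distr μ (fun ω => (X ω, Z ω)) (X ω, Z ω) < distr μ Z (Z ω) := by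
    have := distr_prodMk_add_le hμ X Z (X ω) ω' (Ne.symm hne)
    rw [← hZ] at this
    linarith
  have hlt' := Real.logb_lt_logb one_lt_two
    (hpos.trans_le (le_distr_self hμ (fun ω => (X ω, Z ω)) ω)) hlt
  exact (mul_pos hpos (sub_pos.2 hlt')).ne' hzero

/-- Conditional independence in product form makes the conditional mutual information vanish. -/
lemma cmi_eq_zero_of_distr_mul [Fintype Ω] [Fintype α] [Fintype β] [Fintype γ]
    [DecidableEq α] [DecidableEq β] [DecidableEq γ]
    {μ : Ω → ℝ} (hμ : ∀ ω, 0 ≤ μ ω) (X : Ω → α) (Y : Ω → β) (Z : Ω → γ)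
    (h : ∀ x y z, distr μ (fun ω => (X ω, Y ω, Z ω)) (x, y, z) * distr μ Z z =
      distr μ (fun ω => (X ω, Z ω)) (x, z) * distr μ (fun ω => (Y ω, Z ω)) (y, z)) :
    cmi μ X Y Z = 0 := by
  rw [cmi, H_eq_neg_sum, H_eq_neg_sum, H_eq_neg_sum, H_eq_neg_sum]
  have key : ∑ ω, (μ ω * Real.logb 2 (distr μ (fun ω => (X ω, Y ω, Z ω)) (X ω, Y ω, Z ω))
      + μ ω * Real.logb 2 (distr μ Z (Z ω))) =
      ∑ ω, (μ ω * Real.logb 2 (distr μ (fun ω => (X ω, Z ω)) (X ω, Z ω))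
      + μ ω * Real.logb 2 (distr μ (fun ω => (Y ω, Z ω)) (Y ω, Z ω))) := by
    refine Finset.sum_congr rfl fun ω _ => ?_
    rcases (hμ ω).eq_or_lt with hω | hω
    · simp [← hω]
    · rw [← mul_add, ← mul_add,
        ← Real.logb_mul (hω.trans_le (le_distr_self hμ (fun ω => (X ω, Y ω, Z ω)) ω)).ne'
          (hω.trans_le (le_distr_self hμ Z ω)).ne',
        ← Real.logb_mul (hω.trans_le (le_distr_self hμ (fun ω => (X ω, Z ω)) ω)).ne'
          (hω.trans_le (le_distr_self hμ (fun ω => (Y ω, Z ω)) ω)).ne', h]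
  rw [Finset.sum_add_distrib, Finset.sum_add_distrib] at key
  linarith

lemma sum_distr_fst [Fintype Ω] [Fintype α] [DecidableEq α] [DecidableEq β]
    (μ : Ω → ℝ) (X : Ω → α) (Y : Ω → β) (y : β) :
    ∑ x, distr μ (fun ω => (X ω, Y ω)) (x, y) = distr μ Y y := by
  simp only [distr]
  rw [Finset.sum_comm]
  refine Finset.sum_congr rfl fun ω _ => ?_
  simp [Prod.mk.injEq, ite_and]

lemma sum_distr_mid [Fintype Ω] [Fintype β] [DecidableEq α] [DecidableEq β] [DecidableEq γ]
    (μ : Ω → ℝ) (X : Ω → α) (Y : Ω → β) (Z : Ω → γ) (x : α) (z : γ) :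
    ∑ y, distr μ (fun ω => (X ω, Y ω, Z ω)) (x, y, z) =
      distr μ (fun ω => (X ω, Z ω)) (x, z) := by
  simp only [distr]
  rw [Finset.sum_comm]
  refine Finset.sum_congr rfl fun ω _ => ?_
  by_cases h1 : X ω = x <;> by_cases h2 : Z ω = z <;> simp [h1, h2]

/-- If the joint distribution of `(X, Y)` given `Z` satisfies the rank-one exchange identities,
then `I(X; Y | Z) = 0`. -/
lemma cmi_eq_zero_of_exchange [Fintype Ω] [Fintype α] [Fintype β] [Fintype γ]
    [DecidableEq α] [DecidableEq β] [DecidableEq γ]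
    {μ : Ω → ℝ} (hμ : ∀ ω, 0 ≤ μ ω) (X : Ω → α) (Y : Ω → β) (Z : Ω → γ)
    (h : ∀ x x' y y' z,
      distr μ (fun ω => (X ω, Y ω, Z ω)) (x, y, z) *
          distr μ (fun ω => (X ω, Y ω, Z ω)) (x', y', z) =
        distr μ (fun ω => (X ω, Y ω, Z ω)) (x, y', z) *
          distr μ (fun ω => (X ω, Y ω, Z ω)) (x', y, z)) :
    cmi μ X Y Z = 0 := by
  refine cmi_eq_zero_of_distr_mul hμ X Y Z fun x y z => ?_
  rw [← sum_distr_fst μ Y Z z, ← sum_distr_mid μ X Y Z x z,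
    ← sum_distr_fst μ X (fun ω => (Y ω, Z ω)) (y, z), Finset.mul_sum, Finset.sum_mul]
  refine Finset.sum_congr rfl fun y' _ => ?_
  rw [← sum_distr_fst μ X (fun ω => (Y ω, Z ω)) (y', z), Finset.mul_sum, Finset.mul_sum]
  exact Finset.sum_congr rfl fun x' _ => h x x' y y' z

/-- Summing a product over all vectors whose zeroth coordinate satisfies `P`. -/
lemma sum_ite_zero_prod [Fintype α] {N : ℕ} (f : Fin (N + 1) → α → ℝ)
    (P : α → Prop) [DecidablePred P] :
    (∑ v : Fin (N + 1) → α, if P (v 0) then ∏ k, f k (v k) else 0) =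
      (∑ a, if P a then f 0 a else 0) * ∏ k : Fin N, ∑ a, f k.succ a := by
  rw [Finset.prod_univ_sum, Fintype.piFinset_univ, Finset.sum_mul_sum, ← Fintype.sum_prod_type',
    ← (Fin.consEquiv fun _ : Fin (N + 1) => α).sum_comp]
  refine Finset.sum_congr rfl fun v _ => ?_
  simp [Fin.consEquiv, Fin.prod_univ_succ, ite_mul]

lemma abs_sum_ite_sub_le_l1dist [Fintype α] (p q : α → ℝ) (P : α → Prop) [DecidablePred P] :
    |(∑ a, if P a then p a else 0) - ∑ a, if P a then q a else 0| ≤ l1dist p q := by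
  rw [← Finset.sum_sub_distrib]
  refine (Finset.abs_sum_le_sum_abs _ _).trans (Finset.sum_le_sum fun a _ => ?_)
  split_ifs <;> simp

/-- The joint distribution of the zeroth coordinates when `Y₁` is a function of `X₁` and the
private randomness `M₁`, which is independent of the i.i.d. sources. -/
lemma exists_distr_zero_eq_mul [Fintype Ω] [Fintype 𝒳₁] [Fintype 𝒳₂]
    [DecidableEq 𝒳₁] [DecidableEq 𝒳₂] [DecidableEq 𝒴₁]
    {𝓜₁ 𝓜₂ : Type} [Fintype 𝓜₁] [DecidableEq 𝓜₁] [Fintype 𝓜₂] [DecidableEq 𝓜₂] {N : ℕ}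
    (μ : Ω → ℝ) (X₁ : Ω → Fin (N + 1) → 𝒳₁) (X₂ : Ω → Fin (N + 1) → 𝒳₂)
    (M₁ : Ω → 𝓜₁) (M₂ : Ω → 𝓜₂) (Y : Ω → 𝒴₁) (s : 𝒳₁ × 𝒳₂ → ℝ)
    (hX : distr μ (fun ω => (X₁ ω, X₂ ω)) = fun x => ∏ k, s (x.1 k, x.2 k))
    (hM : distr μ (fun ω => (M₁ ω, M₂ ω, X₁ ω, X₂ ω)) =
        fun m => distr μ M₁ m.1 * distr μ M₂ m.2.1 *
          distr μ (fun ω => (X₁ ω, X₂ ω)) m.2.2)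
    (g : (Fin (N + 1) → 𝒳₁) → 𝓜₁ → 𝒴₁)
    (hg : ∀ ω, μ ω ≠ 0 → Y ω = g (X₁ ω) (M₁ ω)) :
    ∃ T : 𝒴₁ → 𝒳₁ → ℝ, ∀ y x₂ x₁,
      distr μ (fun ω => (Y ω, X₂ ω 0, X₁ ω 0)) (y, x₂, x₁) = s (x₁, x₂) * T y x₁ := by
  refine ⟨fun y x₁ => ∑ m₁, ∑ m₂, ∑ v : Fin (N + 1) → 𝒳₁,
    if g v m₁ = y ∧ v 0 = x₁ then distr μ M₁ m₁ * distr μ M₂ m₂ *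
      ∏ k : Fin N, ∑ a, s (v k.succ, a) else 0, fun y x₂ x₁ => ?_⟩
  have h1 : distr μ (fun ω => (Y ω, X₂ ω 0, X₁ ω 0)) (y, x₂, x₁) =
      ∑ ω, if g (X₁ ω) (M₁ ω) = y ∧ X₂ ω 0 = x₂ ∧ X₁ ω 0 = x₁ then μ ω else 0 := by
    refine Finset.sum_congr rfl fun ω _ => ?_
    by_cases hω : μ ω = 0
    · simp [hω]
    · simp [hg ω hω]
  rw [h1, sum_ite_comp_eq_sum_distr μ (fun ω => (M₁ ω, M₂ ω, X₁ ω, X₂ ω))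
    (fun m => g m.2.2.1 m.1 = y ∧ m.2.2.2 0 = x₂ ∧ m.2.2.1 0 = x₁), hM, hX]
  simp only [Fintype.sum_prod_type, Finset.mul_sum]
  refine Finset.sum_congr rfl fun m₁ _ => Finset.sum_congr rfl fun m₂ _ =>
    Finset.sum_congr rfl fun v _ => ?_
  by_cases hv : g v m₁ = y ∧ v 0 = x₁
  · obtain ⟨hy, hx⟩ := hv
    have h2 := sum_ite_zero_prod (fun k a => s (v k, a)) (fun a => a = x₂)
    simp only [Finset.sum_ite_eq', Finset.mem_univ, if_true, hx] at h2
    simp only [hy, hx, true_and, and_true, and_self, if_true]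
    rw [mul_left_comm, ← h2, Finset.mul_sum]
    exact Finset.sum_congr rfl fun w _ => by split_ifs <;> simp
  · rw [if_neg hv, mul_zero]
    exact Finset.sum_eq_zero fun w _ => if_neg fun h => hv ⟨h.1, h.2.2⟩

/-- The zeroth-coordinate marginal of the i.i.d. extension of a pmf is the pmf itself. -/
lemma sum_ite_prod_eq_distr [Fintype 𝒳₁] [Fintype 𝒳₂] [Fintype 𝒴₁] [Fintype 𝒴₂]
    [DecidableEq 𝒳₁] [DecidableEq 𝒳₂] [DecidableEq 𝒴₁] {N : ℕ}
    {q : 𝒳₁ × 𝒳₂ × 𝒴₁ × 𝒴₂ → ℝ} (hq : ∑ a, q a = 1) (t : 𝒴₁ × 𝒳₂ × 𝒳₁) :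
    (∑ a : (Fin (N + 1) → 𝒳₁) × (Fin (N + 1) → 𝒳₂) × (Fin (N + 1) → 𝒴₁) × (Fin (N + 1) → 𝒴₂),
      if (a.2.2.1 0, a.2.1 0, a.1 0) = t
      then ∏ k, q (a.1 k, a.2.1 k, a.2.2.1 k, a.2.2.2 k) else 0) =
    distr q (fun a => (a.2.2.1, a.2.1, a.1)) t := by
  have h := sum_ite_zero_prod (N := N) (fun _ a => q a)
    (fun a : 𝒳₁ × 𝒳₂ × 𝒴₁ × 𝒴₂ => (a.2.2.1, a.2.1, a.1) = t)
  simp only [hq, Finset.prod_const_one, mul_one] at h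
  rw [distr, ← h]
  let e : ((Fin (N + 1) → 𝒳₁) × (Fin (N + 1) → 𝒳₂) × (Fin (N + 1) → 𝒴₁) × (Fin (N + 1) → 𝒴₂)) ≃
      (Fin (N + 1) → 𝒳₁ × 𝒳₂ × 𝒴₁ × 𝒴₂) :=
    { toFun := fun a k => (a.1 k, a.2.1 k, a.2.2.1 k, a.2.2.2 k)
      invFun := fun v => (fun k => (v k).1, fun k => (v k).2.1, fun k => (v k).2.2.1,
        fun k => (v k).2.2.2)
      left_inv := fun _ => rfl
      right_inv := fun _ => rfl }
  exact e.sum_comp fun v : Fin (N + 1) → 𝒳₁ × 𝒳₂ × 𝒴₁ × 𝒴₂ =>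
    if ((v 0).2.2.1, (v 0).2.1, (v 0).1) = t then ∏ k, q (v k) else 0

/-- With a single message from node 1, the `(y¹, x², x¹)`-marginal of the target is approximated
by functions of the form `s(x¹, x²) T(y¹, x¹)`. -/
lemma Admissible.exists_approx [Fintype 𝒳₁] [DecidableEq 𝒳₁] [Fintype 𝒳₂] [DecidableEq 𝒳₂]
    [Fintype 𝒴₁] [DecidableEq 𝒴₁] [Fintype 𝒴₂] [DecidableEq 𝒴₂]
    {q : 𝒳₁ × 𝒳₂ × 𝒴₁ × 𝒴₂ → ℝ} (hq : IsPMF q) {R12 R21 : ℝ}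
    (hadm : Admissible q 1 R12 R21) {ε : ℝ} (hε : 0 < ε) :
    ∃ T : 𝒴₁ → 𝒳₁ → ℝ, ∀ y x₂ x₁, |srcMarg q (x₁, x₂) * T y x₁ -
      distr q (fun a => (a.2.2.1, a.2.1, a.1)) (y, x₂, x₁)| ≤ ε := by
  obtain ⟨N, hN⟩ := hadm ε hε
  obtain ⟨Ω, 𝓜₁, 𝓜₂, 𝓒, _, _, _, _, _, _, _, _, μ, X₁, X₂, M₁, M₂, C, Y₁, Y₂,
    hμ, hX, hM, hC, -, -, -, hY, -, hd⟩ := hN (N + 1) N.le_succ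
  have hfun (ω ω' : Ω) (hω : μ ω ≠ 0) (hω' : μ ω' ≠ 0) (h1 : X₁ ω = X₁ ω')
      (h2 : M₁ ω = M₁ ω') : Y₁ ω = Y₁ ω' := by
    have hC0 : C 0 ω = C 0 ω' :=
      eq_of_condEnt_eq_zero hμ.1 (hC 0 rfl) hω hω'
        (Prod.ext (funext fun j => j.elim0) (Prod.ext h1 h2))
    refine eq_of_condEnt_eq_zero hμ.1 hY hω hω'
      (Prod.ext h1 (Prod.ext h2 (funext fun i => ?_)))
    rw [Subsingleton.elim i 0]
    exact hC0
  obtain ⟨ω₀, -⟩ : ∃ ω, μ ω ≠ 0 := by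
    by_contra! h
    simpa [h] using hμ.2
  classical
  let g : (Fin (N + 1) → 𝒳₁) → 𝓜₁ → 𝒴₁ := fun x m =>
    if h : ∃ ω, μ ω ≠ 0 ∧ X₁ ω = x ∧ M₁ ω = m then Y₁ h.choose 0 else Y₁ ω₀ 0
  have hg (ω : Ω) (hω : μ ω ≠ 0) : Y₁ ω 0 = g (X₁ ω) (M₁ ω) := by
    have h : ∃ ω', μ ω' ≠ 0 ∧ X₁ ω' = X₁ ω ∧ M₁ ω' = M₁ ω := ⟨ω, hω, rfl, rfl⟩
    simp only [g, dif_pos h]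
    obtain ⟨h0, h1, h2⟩ := h.choose_spec
    rw [hfun ω _ hω h0 h1.symm h2.symm]
  obtain ⟨T, hT⟩ := exists_distr_zero_eq_mul μ X₁ X₂ M₁ M₂ (fun ω => Y₁ ω 0) (srcMarg q)
    hX hM g hg
  refine ⟨T, fun y x₂ x₁ => ?_⟩
  rw [← hT, ← sum_ite_prod_eq_distr (N := N) hq.2 (y, x₂, x₁)]
  refine le_trans (le_of_eq ?_) ((abs_sum_ite_sub_le_l1dist _ _
    (fun a : (Fin (N + 1) → 𝒳₁) × (Fin (N + 1) → 𝒳₂) × (Fin (N + 1) → 𝒴₁) × (Fin (N + 1) → 𝒴₂) =>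
      (a.2.2.1 0, a.2.1 0, a.1 0) = (y, x₂, x₁))).trans hd)
  rw [← sum_ite_comp_eq_sum_distr]
  rfl

/-- If `(R12, 0)` is admissible for `q` with one round of communication,
then the Markov chain `Y¹ – X¹ – X²` holds under `q`, i.e. `I_q(Y¹; X² | X¹) = 0`.
Here the mutual information is computed using `q` itself as the underlying pmf and the
coordinate projections as random variables. -/
theorem one_round_admissible_markov
    [Fintype 𝒳₁] [DecidableEq 𝒳₁] [Fintype 𝒳₂] [DecidableEq 𝒳₂]
    [Fintype 𝒴₁] [DecidableEq 𝒴₁] [Fintype 𝒴₂] [DecidableEq 𝒴₂]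
    (q : 𝒳₁ × 𝒳₂ × 𝒴₁ × 𝒴₂ → ℝ) (hq : IsPMF q) (R12 : ℝ)
    (hadm : Admissible q 1 R12 0) :
    cmi q (fun a => a.2.2.1) (fun a => a.2.1) (fun a => a.1) = 0 := by
  choose T hT using fun n : ℕ => hadm.exists_approx hq (Nat.one_div_pos_of_nat (α := ℝ) (n := n))
  have hlim (y : 𝒴₁) (x₂ : 𝒳₂) (x₁ : 𝒳₁) :
      Filter.Tendsto (fun n => srcMarg q (x₁, x₂) * T n y x₁) Filter.atTop
        (nhds (distr q (fun a => (a.2.2.1, a.2.1, a.1)) (y, x₂, x₁))) :=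
    tendsto_iff_norm_sub_tendsto_zero.2 <| squeeze_zero (fun _ => norm_nonneg _)
      (fun n => hT n y x₂ x₁) tendsto_one_div_add_atTop_nhds_zero_nat
  refine cmi_eq_zero_of_exchange hq.1 _ _ _ fun y y' x₂ x₂' x₁ => ?_
  refine tendsto_nhds_unique ((hlim y x₂ x₁).mul (hlim y' x₂' x₁)) ?_
  refine ((hlim y x₂' x₁).mul (hlim y' x₂ x₁)).congr fun n => ?_
  ring

end Coord
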